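/- Let $(\Omega, \mathcal{F}, \mathbb{P})$ be a probability space and let $\mathcal{G}_1, \mathcal{G}_2$ be sub-$\sigma$-fields of $\mathcal{F}$. Let $T_1 = \mathbb{E}[\cdot\,|\,\mathcal{G}_1]$, $T_2 = \mathbb{E}[\cdot\,|\,\mathcal{G}_2]$, and define $S_n$ to be the alternating product $S_1 = T_1$, $S_2 = T_2 T_1$, $S_3 = T_1 T_2 T_1$, etc. Then for every $X \in L_2(\Omega,\mathcal{F},\mathbb{P})$, $S_n X \to \mathbb{E}[X\,|\,\bar{\mathcal{G}_1} \cap \bar{\mathcal{G}_2}]$ as $n \to \infty$, both in $L_2$-norm and almost surely, where $\bar{\mathcal{G}_i}$ denotes the completion of $\mathcal{G}_i$ with respect to $\mathbb{P}$ (the $\sigma$-field generated by $\mathcal{G}_i$ and the $\mathbb{P}$-null sets of $\mathcal{F}$). -/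

import Mathlib

open Filter MeasureTheory
open scoped ENNReal NNReal

section Hilbert

variable {E : Type*} [NormedAddCommGroup E] [InnerProductSpace ℝ E]

theorem inner_pow_apply_eq {A : E →L[ℝ] E} (hA : ∀ x y, inner ℝ (A x) y = inner ℝ x (A y))
    (m n : ℕ) (x y : E) :
    inner ℝ ((A ^ m) x) ((A ^ n) y) = inner ℝ ((A ^ (m + n)) x) y := by
  induction n generalizing m with
  | zero => simp
  | succ n ih =>
    rw [pow_succ', mul_apply_eq_comp, ← hA, ← mul_apply_eq_comp,
      ← pow_succ', ih, show m + 1 + n = m + (n + 1) by ring]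

/-- `∑ (m + 1) Δ²a_m ≤ a_0` for a nonnegative decreasing sequence. -/
theorem sum_mul_second_diff_le {a : ℕ → ℝ} (ha : ∀ m, 0 ≤ a m) (hd : ∀ m, a (m + 1) ≤ a m)
    (N : ℕ) :
    ∑ m ∈ Finset.range N, (m + 1 : ℝ) * (a m - 2 * a (m + 1) + a (m + 2)) ≤ a 0 := by
  have key : ∀ N : ℕ, ∑ m ∈ Finset.range N, (m + 1 : ℝ) * (a m - 2 * a (m + 1) + a (m + 2))
      = a 0 - a N - N * (a N - a (N + 1)) := by
    intro N
    induction N with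
    | zero => simp
    | succ n ih => rw [Finset.sum_range_succ, ih]; push_cast; ring
  rw [key]
  have := mul_nonneg (Nat.cast_nonneg (α := ℝ) N) (sub_nonneg.2 (hd N))
  linarith [ha N]

theorem sum_mul_norm_pow_sub_sq_le {A : E →L[ℝ] E}
    (hA : ∀ x y, inner ℝ (A x) y = inner ℝ x (A y)) (hpos : ∀ x, 0 ≤ inner ℝ (A x) x)
    (hc : ∀ x, ‖A x‖ ≤ ‖x‖) (x : E) (N : ℕ) :
    ∑ n ∈ Finset.range N, (n + 1 : ℝ) * ‖(A ^ n) x - (A ^ (n + 1)) x‖ ^ 2 ≤ ‖x‖ ^ 2 := by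
  set a : ℕ → ℝ := fun m => inner ℝ ((A ^ m) x) x with ha
  have e1 : ∀ m n, inner ℝ ((A ^ m) x) ((A ^ n) x) = a (m + n) :=
    fun m n => inner_pow_apply_eq hA m n x x
  have hsucc : ∀ n (y : E), (A ^ (n + 1)) y = A ((A ^ n) y) := fun n y => by
    rw [pow_succ', mul_apply_eq_comp]
  have even_or : ∀ m, ∃ n, m = n + n ∨ m = n + (n + 1) := fun m => by
    rcases Nat.even_or_odd' m with ⟨n, h | h⟩ <;> exact ⟨n, by omega⟩
  have ha0 : ∀ m, 0 ≤ a m := by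
    intro m
    obtain ⟨n, rfl | rfl⟩ := even_or m
    · rw [← e1]; exact real_inner_self_nonneg
    · rw [← e1, real_inner_comm, hsucc]; exact hpos _
  have hsq : ∀ n, ‖(A ^ n) x - (A ^ (n + 1)) x‖ ^ 2
      = a (2 * n) - 2 * a (2 * n + 1) + a (2 * n + 2) := by
    intro n
    rw [norm_sub_sq_real, ← real_inner_self_eq_norm_sq, ← real_inner_self_eq_norm_sq, e1, e1, e1]
    ring_nf
  have hdd : ∀ m, 0 ≤ a m - 2 * a (m + 1) + a (m + 2) := by
    intro m
    obtain ⟨n, rfl | rfl⟩ := even_or m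
    · have := hsq n
      rw [two_mul] at this
      rw [← this]; positivity
    · have h := hpos ((A ^ n) x - (A ^ (n + 1)) x)
      rw [map_sub, ← hsucc, ← hsucc, inner_sub_left, inner_sub_right, inner_sub_right,
        e1, e1, e1, e1] at h
      have e : a (n + 1 + (n + 1)) = a (n + (n + 1) + 1) := by ring_nf
      have e' : a (n + 1 + 1 + n) = a (n + (n + 1) + 1) := by ring_nf
      have e'' : a (n + 1 + 1 + (n + 1)) = a (n + (n + 1) + 2) := by ring_nf
      have e3 : a (n + 1 + n) = a (n + (n + 1)) := by ring_nf
      rw [e, e', e'', e3] at h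
      linarith
  have heven : ∀ n, a (n + n + 1) ≤ a (n + n) := by
    intro n
    rw [add_assoc, ← e1, ← e1]
    calc _ ≤ ‖(A ^ n) x‖ * ‖(A ^ (n + 1)) x‖ := real_inner_le_norm _ _
      _ ≤ ‖(A ^ n) x‖ * ‖(A ^ n) x‖ := by
        gcongr; rw [hsucc]; exact hc _
      _ = _ := by rw [real_inner_self_eq_norm_mul_norm]
  have hd : ∀ m, a (m + 1) ≤ a m := by
    intro m
    obtain ⟨n, rfl | rfl⟩ := even_or m
    · exact heven n
    · have h1 := hdd (n + (n + 1))
      have h2 := heven (n + 1)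
      have e : a (n + 1 + (n + 1)) = a (n + (n + 1) + 1) := by ring_nf
      have e' : a (n + 1 + (n + 1) + 1) = a (n + (n + 1) + 2) := by ring_nf
      rw [e, e'] at h2
      linarith
  calc ∑ n ∈ Finset.range N, (n + 1 : ℝ) * ‖(A ^ n) x - (A ^ (n + 1)) x‖ ^ 2
      ≤ ∑ n ∈ Finset.range N, ((2 * n : ℕ) + 1 : ℝ) *
          (a (2 * n) - 2 * a (2 * n + 1) + a (2 * n + 2)) := by
        refine Finset.sum_le_sum fun n _ => ?_
        rw [hsq]
        refine mul_le_mul_of_nonneg_right ?_ (hdd _)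
        push_cast; linarith [Nat.cast_nonneg (α := ℝ) n]
    _ = ∑ m ∈ (Finset.range N).image (fun n => 2 * n), ((m : ℕ) + 1 : ℝ) *
          (a m - 2 * a (m + 1) + a (m + 2)) := by
        rw [Finset.sum_image (fun i _ j _ h => by simpa using h)]
    _ ≤ ∑ m ∈ Finset.range (2 * N), (m + 1 : ℝ) * (a m - 2 * a (m + 1) + a (m + 2)) := by
        refine Finset.sum_le_sum_of_subset_of_nonneg ?_ fun m _ _ =>
          mul_nonneg (by positivity) (hdd m)
        intro m hm
        simp only [Finset.mem_image, Finset.mem_range] at hm ⊢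
        omega
    _ ≤ a 0 := sum_mul_second_diff_le ha0 hd _
    _ = ‖x‖ ^ 2 := by simp [ha]

theorem summable_norm_pow_sub_sq {A : E →L[ℝ] E}
    (hA : ∀ x y, inner ℝ (A x) y = inner ℝ x (A y)) (hpos : ∀ x, 0 ≤ inner ℝ (A x) x)
    (hc : ∀ x, ‖A x‖ ≤ ‖x‖) (x : E) :
    Summable fun n => ‖(A ^ n) x - (A ^ (n + 1)) x‖ ^ 2 := by
  refine summable_of_sum_range_le (c := ‖x‖ ^ 2) (fun n => by positivity) fun N => ?_
  refine le_trans (Finset.sum_le_sum fun n _ => ?_) (sum_mul_norm_pow_sub_sq_le hA hpos hc x N)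
  refine le_mul_of_one_le_left (by positivity) ?_
  linarith [Nat.cast_nonneg (α := ℝ) n]

theorem norm_pow_apply_le {A : E →L[ℝ] E} (hc : ∀ x, ‖A x‖ ≤ ‖x‖) (n : ℕ) (x : E) :
    ‖(A ^ n) x‖ ≤ ‖x‖ := by
  induction n with
  | zero => simp
  | succ n ih =>
    rw [pow_succ', mul_apply_eq_comp]
    exact (hc _).trans ih

/-- A vector orthogonal to the fixed points of a symmetric operator `A` is approximated by
vectors of the form `y - A y`. -/
theorem exists_norm_sub_lt_of_orthogonal_fixed [CompleteSpace E] {A : E →L[ℝ] E}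
    (hA : ∀ x y, inner ℝ (A x) y = inner ℝ x (A y)) {z : E}
    (hz : ∀ y, A y = y → inner ℝ z y = 0) {ε : ℝ} (hε : 0 < ε) :
    ∃ y, ‖z - (y - A y)‖ < ε := by
  have hsa : ContinuousLinearMap.adjoint (1 - A) = 1 - A := by
    refine ((ContinuousLinearMap.eq_adjoint_iff _ _).2 fun x y => ?_).symm
    simp [inner_sub_left, inner_sub_right, hA]
  have hmem : z ∈ (LinearMap.ker (1 - A : E →L[ℝ] E).toLinearMap)ᗮ := by
    rw [Submodule.mem_orthogonal']
    intro y hy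
    refine hz y ?_
    have : y - A y = 0 := by simpa using hy
    exact (sub_eq_zero.1 this).symm
  rw [ContinuousLinearMap.orthogonal_ker, hsa] at hmem
  obtain ⟨w, ⟨y, rfl⟩, hw⟩ := Metric.mem_closure_iff.1 hmem ε hε
  exact ⟨y, by simpa [dist_eq_norm] using hw⟩

theorem tendsto_pow_apply_zero_of_orthogonal_fixed [CompleteSpace E] {A : E →L[ℝ] E}
    (hA : ∀ x y, inner ℝ (A x) y = inner ℝ x (A y)) (hpos : ∀ x, 0 ≤ inner ℝ (A x) x)
    (hc : ∀ x, ‖A x‖ ≤ ‖x‖) {z : E} (hz : ∀ y, A y = y → inner ℝ z y = 0) :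
    Tendsto (fun n => (A ^ n) z) atTop (nhds 0) := by
  rw [Metric.tendsto_atTop]
  intro ε hε
  obtain ⟨y, hy⟩ := exists_norm_sub_lt_of_orthogonal_fixed hA hz (half_pos hε)
  have h1 := (summable_norm_pow_sub_sq hA hpos hc y).tendsto_atTop_zero
  obtain ⟨N, hN⟩ := Metric.tendsto_atTop.1 h1 ((ε / 2) ^ 2) (by positivity)
  refine ⟨N, fun n hn => ?_⟩
  have h2 := hN n hn
  rw [dist_zero_right, Real.norm_of_nonneg (by positivity)] at h2
  have h3 := lt_of_pow_lt_pow_left₀ 2 (by positivity) h2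
  have h4 : (A ^ n) z = (A ^ n) (z - (y - A y)) + ((A ^ n) y - (A ^ (n + 1)) y) := by
    rw [pow_succ, mul_apply_eq_comp, map_sub, map_sub]; abel
  rw [dist_zero_right, h4]
  calc _ ≤ ‖(A ^ n) (z - (y - A y))‖ + ‖(A ^ n) y - (A ^ (n + 1)) y‖ := norm_add_le _ _
    _ < ε / 2 + ε / 2 := add_lt_add ((norm_pow_apply_le hc _ _).trans_lt hy) h3
    _ = ε := by ring

end Hilbert

section MaximalInequality

variable {Ω : Type*} {m0 : MeasurableSpace Ω} {μ : Measure Ω}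

theorem ae_tendsto_zero_of_summable_norm_sq {f : ℕ → Lp ℝ 2 μ}
    (hf : Summable fun n => ‖f n‖ ^ 2) :
    ∀ᵐ ω ∂μ, Tendsto (fun n => f n ω) atTop (nhds 0) := by
  have hnorm : ∀ n, ∫⁻ ω, ‖f n ω‖ₑ ^ 2 ∂μ = ENNReal.ofReal (‖f n‖ ^ 2) := by
    intro n
    have h := eLpNorm_nnreal_pow_eq_lintegral (μ := μ) (f := f n) (p := 2) two_ne_zero
    simp only [NNReal.coe_ofNat, ENNReal.rpow_ofNat, ENNReal.coe_ofNat] at h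
    rw [← h, ← Lp.enorm_def, ← ofReal_norm, ENNReal.ofReal_pow (norm_nonneg _)]
  have hmeas : ∀ n, AEMeasurable (fun ω => ‖f n ω‖ₑ ^ 2) μ := fun n =>
    (Lp.aestronglyMeasurable (f n)).enorm.pow_const 2
  have hfin : ∫⁻ ω, ∑' n, ‖f n ω‖ₑ ^ 2 ∂μ ≠ ∞ := by
    rw [lintegral_tsum hmeas]
    simp_rw [hnorm]
    exact hf.tsum_ofReal_ne_top
  filter_upwards [ae_lt_top' (AEMeasurable.tsum hmeas) hfin] with ω hω
  have h := ENNReal.tendsto_atTop_zero_of_tsum_ne_top hω.ne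
  have h2 := (ENNReal.continuous_rpow_const (y := 1 / 2)).continuousAt.tendsto.comp h
  simp only [Function.comp_def] at h2
  rw [tendsto_zero_iff_enorm_tendsto_zero]
  convert h2 using 2 with n
  · rw [← ENNReal.rpow_ofNat, ← ENNReal.rpow_mul]; simp
  · simp

theorem setIntegral_le_norm [IsProbabilityMeasure μ] (f : Lp ℝ 2 μ) (s : Set Ω) :
    ∫ ω in s, f ω ∂μ ≤ ‖f‖ := by
  have hi : Integrable f μ := (Lp.memLp f).integrable (by norm_num)
  calc ∫ ω in s, f ω ∂μ ≤ ∫ ω in s, ‖f ω‖ ∂μ :=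
        integral_mono hi.integrableOn hi.norm.integrableOn fun ω => Real.le_norm_self _
    _ ≤ ∫ ω, ‖f ω‖ ∂μ := setIntegral_le_integral hi.norm (ae_of_all _ fun _ => norm_nonneg _)
    _ = (eLpNorm f 1 μ).toReal := by
        rw [eLpNorm_one_eq_lintegral_enorm, integral_norm_eq_lintegral_enorm hi.1]
    _ ≤ (eLpNorm f 2 μ).toReal := ENNReal.toReal_mono (Lp.eLpNorm_ne_top f)
        (eLpNorm_le_eLpNorm_of_exponent_le (by norm_num) hi.1)
    _ = ‖f‖ := (Lp.norm_def f).symm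

theorem integral_sq_eq_norm_sq (f : Lp ℝ 2 μ) : ∫ ω, f ω ^ 2 ∂μ = ‖f‖ ^ 2 := by
  rw [← real_inner_self_eq_norm_sq, L2.inner_def]
  simp [pow_two]

/-- The maximal functions `max (0, f, f + A f, …)` of the partial sums of the iterates. -/
noncomputable def maxPartialSum (A : Lp ℝ 2 μ →L[ℝ] Lp ℝ 2 μ) (f : Lp ℝ 2 μ) : ℕ → Lp ℝ 2 μ
  | 0 => 0
  | n + 1 => (f + A (maxPartialSum A f n)) ⊔ 0

theorem monotone_of_map_nonneg {A : Lp ℝ 2 μ →L[ℝ] Lp ℝ 2 μ} (hA : ∀ f, 0 ≤ f → 0 ≤ A f) :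
    Monotone A := fun f g h => by
  have := hA (g - f) (sub_nonneg.2 h)
  rwa [map_sub, sub_nonneg] at this

theorem maxPartialSum_nonneg (A : Lp ℝ 2 μ →L[ℝ] Lp ℝ 2 μ) (f : Lp ℝ 2 μ) (n : ℕ) :
    0 ≤ maxPartialSum A f n := by
  cases n with
  | zero => exact le_rfl
  | succ n => exact le_sup_right

theorem maxPartialSum_monotone {A : Lp ℝ 2 μ →L[ℝ] Lp ℝ 2 μ} (hA : ∀ f, 0 ≤ f → 0 ≤ A f)
    (f : Lp ℝ 2 μ) : Monotone (maxPartialSum A f) := by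
  refine monotone_nat_of_le_succ fun n => ?_
  induction n with
  | zero => exact maxPartialSum_nonneg A f 1
  | succ n ih =>
    exact sup_le_sup_right (by gcongr; exact monotone_of_map_nonneg hA ih) 0

theorem sum_pow_le_maxPartialSum {A : Lp ℝ 2 μ →L[ℝ] Lp ℝ 2 μ} (hA : ∀ f, 0 ≤ f → 0 ≤ A f)
    (f : Lp ℝ 2 μ) (n : ℕ) :
    ∑ k ∈ Finset.range n, (A ^ k) f ≤ maxPartialSum A f n := by
  induction n with
  | zero => simp [maxPartialSum]
  | succ n ih =>
    refine le_trans (le_of_eq ?_) (le_trans (add_le_add_right (monotone_of_map_nonneg hA ih) f)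
      le_sup_left)
    rw [Finset.sum_range_succ', map_sum, add_comm]
    simp [pow_succ']

/-- The Hopf maximal ergodic lemma. -/
theorem setIntegral_maxPartialSum_nonneg [IsProbabilityMeasure μ]
    {A : Lp ℝ 2 μ →L[ℝ] Lp ℝ 2 μ}
    (hA : ∀ f, 0 ≤ f → 0 ≤ A f) (hint : ∀ f, ∫ ω, A f ω ∂μ = ∫ ω, f ω ∂μ) (f : Lp ℝ 2 μ) (n : ℕ) :
    0 ≤ ∫ ω in {ω | 0 < maxPartialSum A f n ω}, f ω ∂μ := by
  cases n with
  | zero =>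
    have : ∀ᵐ ω ∂μ, ω ∉ {ω | 0 < maxPartialSum A f 0 ω} := by
      filter_upwards [Lp.coeFn_zero ℝ 2 μ] with ω hω
      simp [maxPartialSum]
    rw [Measure.restrict_eq_zero.2 (by simpa [ae_iff] using this)]
    simp
  | succ n =>
    set M := maxPartialSum A f (n + 1) with hM
    have hi : ∀ g : Lp ℝ 2 μ, Integrable g μ := fun g => (Lp.memLp g).integrable (by norm_num)
    have hmeas : MeasurableSet {ω | 0 < M ω} :=
      measurableSet_lt measurable_const (Lp.stronglyMeasurable M).measurable
    have hle : maxPartialSum A f n ≤ M := maxPartialSum_monotone hA f (Nat.le_succ n)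
    have hMdef : M = (f + A (maxPartialSum A f n)) ⊔ 0 := rfl
    have hAM : 0 ≤ A M := hA _ (maxPartialSum_nonneg A f _)
    have key : ∫ ω, M ω - A M ω ∂μ ≤ ∫ ω, {ω | 0 < M ω}.indicator f ω ∂μ := by
      refine integral_mono_ae ((hi _).sub (hi _)) ((hi f).indicator hmeas) ?_
      filter_upwards [Lp.coeFn_sup (f + A (maxPartialSum A f n)) 0, Lp.coeFn_zero ℝ 2 μ,
        Lp.coeFn_add f (A (maxPartialSum A f n)),
        (Lp.coeFn_le _ _).2 (monotone_of_map_nonneg hA hle), (Lp.coeFn_le _ _).2 hAM]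
        with ω h1 h0 h2 h3 h4
      rw [← hMdef, Pi.sup_apply, h2, h0, Pi.add_apply, Pi.zero_apply] at h1
      rw [h0, Pi.zero_apply] at h4
      by_cases hω : 0 < M ω
      · rw [Set.indicator_of_mem (by exact hω)]
        rcases max_choice (f ω + A (maxPartialSum A f n) ω) 0 with h | h
        · have : M ω = f ω + A (maxPartialSum A f n) ω := h1.trans h
          linarith
        · have : M ω = 0 := h1.trans h
          exact absurd hω (by rw [this]; exact lt_irrefl _)
      · rw [Set.indicator_of_notMem (by exact hω)]
        linarith
    rw [← integral_indicator hmeas]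
    refine le_trans (le_of_eq ?_) key
    rw [integral_sub (hi _) (hi _), hint, sub_self]

theorem measureReal_maxPartialSum_sub_const_pos_le [IsProbabilityMeasure μ]
    {A : Lp ℝ 2 μ →L[ℝ] Lp ℝ 2 μ}
    (hA : ∀ f, 0 ≤ f → 0 ≤ A f) (hint : ∀ f, ∫ ω, A f ω ∂μ = ∫ ω, f ω ∂μ) (f : Lp ℝ 2 μ)
    (c : ℝ) (n : ℕ) :
    c * μ.real {ω | 0 < maxPartialSum A (f - Lp.const 2 μ c) n ω} ≤ ‖f‖ := by
  set s := {ω | 0 < maxPartialSum A (f - Lp.const 2 μ c) n ω} with hs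
  have hi : Integrable f μ := (Lp.memLp f).integrable (by norm_num)
  have h0 : 0 ≤ ∫ ω in s, (f - Lp.const 2 μ c : Lp ℝ 2 μ) ω ∂μ :=
    setIntegral_maxPartialSum_nonneg hA hint _ n
  have h1 : ∫ ω in s, (f - Lp.const 2 μ c : Lp ℝ 2 μ) ω ∂μ = ∫ ω in s, (f ω - c) ∂μ := by
    refine integral_congr_ae (ae_restrict_of_ae ?_)
    filter_upwards [Lp.coeFn_sub f (Lp.const 2 μ c), Lp.coeFn_const 2 μ c] with ω h1 h2
    rw [h1, Pi.sub_apply, h2, Function.const_apply]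
  rw [h1, integral_sub hi.integrableOn (integrable_const c), setIntegral_const, smul_eq_mul] at h0
  have := setIntegral_le_norm f s
  linarith [mul_comm c (μ.real s)]

theorem pow_apply_const [IsFiniteMeasure μ] {A : Lp ℝ 2 μ →L[ℝ] Lp ℝ 2 μ} {c : ℝ}
    (hc : A (Lp.const 2 μ c) = Lp.const 2 μ c) (n : ℕ) :
    (A ^ n) (Lp.const 2 μ c) = Lp.const 2 μ c := by
  induction n with
  | zero => simp
  | succ n ih => rw [pow_succ, mul_apply_eq_comp, hc, ih]

theorem ae_coeFn_sum (f : ℕ → Lp ℝ 2 μ) (n : ℕ) :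
    ((∑ k ∈ Finset.range n, f k : Lp ℝ 2 μ) : Ω → ℝ) =ᵐ[μ]
      fun ω => ∑ k ∈ Finset.range n, f k ω := by
  induction n with
  | zero =>
    simp only [Finset.range_zero, Finset.sum_empty]
    exact Lp.coeFn_zero ℝ 2 μ
  | succ n ih =>
    simp_rw [Finset.sum_range_succ]
    filter_upwards [ih, Lp.coeFn_add (∑ k ∈ Finset.range n, f k) (f n)] with ω h1 h2
    rw [h2, Pi.add_apply, h1]

theorem ae_sum_pow_le_of_maxPartialSum_nonpos [IsFiniteMeasure μ]
    {A : Lp ℝ 2 μ →L[ℝ] Lp ℝ 2 μ} (hA : ∀ f, 0 ≤ f → 0 ≤ A f) {c : ℝ}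
    (hc : A (Lp.const 2 μ c) = Lp.const 2 μ c) (f : Lp ℝ 2 μ) {n N : ℕ} (hn : n ≤ N) :
    ∀ᵐ ω ∂μ, ¬ 0 < maxPartialSum A (f - Lp.const 2 μ c) N ω →
      ∑ k ∈ Finset.range n, (A ^ k) f ω ≤ n * c := by
  have h1 := (sum_pow_le_maxPartialSum hA (f - Lp.const 2 μ c) n).trans
    (maxPartialSum_monotone hA (f - Lp.const 2 μ c) hn)
  have h2 : ∀ k, ∀ᵐ ω ∂μ, (A ^ k) (f - Lp.const 2 μ c) ω = (A ^ k) f ω - c := by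
    intro k
    rw [map_sub, pow_apply_const hc]
    filter_upwards [Lp.coeFn_sub ((A ^ k) f) (Lp.const 2 μ c), Lp.coeFn_const 2 μ c] with ω h1 h2
    rw [h1, Pi.sub_apply, h2, Function.const_apply]
  filter_upwards [(Lp.coeFn_le _ _).2 h1, ae_all_iff.2 h2,
    ae_coeFn_sum (fun k => (A ^ k) (f - Lp.const 2 μ c)) n] with ω h3 h4 h5 h6
  rw [h5] at h3
  simp_rw [h4] at h3
  rw [Finset.sum_sub_distrib] at h3
  simp only [Finset.sum_const, Finset.card_range, nsmul_eq_mul] at h3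
  linarith

theorem abs_le_two_mul_of_abs_sum_le {u : ℕ → ℝ} {c : ℝ} (hc : 0 ≤ c) {n N : ℕ} (hn : n < N)
    (hsum : |∑ k ∈ Finset.range (n + 1), u k| ≤ (n + 1) * c)
    (hsq : ∑ j ∈ Finset.range N, (j + 1 : ℝ) * (u j - u (j + 1)) ^ 2 ≤ c ^ 2) :
    |u n| ≤ 2 * c := by
  have key : ∀ n : ℕ, ∑ k ∈ Finset.range (n + 1), u k
      = (n + 1) * u n + ∑ j ∈ Finset.range n, (j + 1 : ℝ) * (u j - u (j + 1)) := by
    intro n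
    induction n with
    | zero => simp
    | succ n ih => rw [Finset.sum_range_succ, ih, Finset.sum_range_succ]; push_cast; ring
  have hle : ∀ j ∈ Finset.range n, (j + 1 : ℝ) ≤ n + 1 := by
    intro j hj
    have := (Finset.mem_range.1 hj).le
    have : (j : ℝ) ≤ n := by exact_mod_cast this
    linarith
  have hone : ∑ j ∈ Finset.range n, (j + 1 : ℝ) ≤ (n + 1) * (n + 1) := by
    refine (Finset.sum_le_sum hle).trans ?_
    simp only [Finset.sum_const, Finset.card_range, nsmul_eq_mul]
    nlinarith [Nat.cast_nonneg (α := ℝ) n]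
  have hcs : (∑ j ∈ Finset.range n, (j + 1 : ℝ) * (u j - u (j + 1))) ^ 2 ≤ ((n + 1) * c) ^ 2 := by
    calc _ ≤ (∑ j ∈ Finset.range n, (j + 1 : ℝ)) *
          ∑ j ∈ Finset.range n, (j + 1 : ℝ) * (u j - u (j + 1)) ^ 2 :=
        Finset.sum_sq_le_sum_mul_sum_of_sq_le_mul _ (fun j _ => by positivity)
          (fun j _ => by positivity) (fun j _ => le_of_eq (by ring))
      _ ≤ ((n + 1) * (n + 1)) * c ^ 2 := by
        refine mul_le_mul hone (le_trans ?_ hsq) (Finset.sum_nonneg fun j _ => by positivity)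
          (by positivity)
        exact Finset.sum_le_sum_of_subset_of_nonneg
          (Finset.range_subset_range.2 hn.le) fun j _ _ => by positivity
      _ = _ := by ring
  have habs := abs_le.1 (abs_le_of_sq_le_sq hcs (by positivity))
  have hk := key n
  have h1 := abs_le.1 hsum
  have hn0 : (0 : ℝ) < n + 1 := by positivity
  rw [abs_le]
  constructor
  · refine le_of_mul_le_mul_left ?_ hn0
    linarith [habs.1, habs.2]
  · refine le_of_mul_le_mul_left ?_ hn0
    linarith [habs.1, habs.2]

/-- A weak type maximal inequality for the iterates of a symmetric Markov operator. -/
theorem measureReal_exists_lt_abs_pow_le [IsProbabilityMeasure μ]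
    {A : Lp ℝ 2 μ →L[ℝ] Lp ℝ 2 μ}
    (hsymm : ∀ x y, inner ℝ (A x) y = inner ℝ x (A y)) (hpsd : ∀ x, 0 ≤ inner ℝ (A x) x)
    (hcontr : ∀ x, ‖A x‖ ≤ ‖x‖)
    (hA : ∀ f, 0 ≤ f → 0 ≤ A f) (hint : ∀ f, ∫ ω, A f ω ∂μ = ∫ ω, f ω ∂μ)
    (hconst : ∀ c, A (Lp.const 2 μ c) = Lp.const 2 μ c) (f : Lp ℝ 2 μ) {c : ℝ} (hc : 0 < c)
    (N : ℕ) :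
    μ.real {ω | ∃ n < N, 2 * c < |(A ^ n) f ω|} ≤ ‖f‖ / c + ‖f‖ / c + ‖f‖ ^ 2 / c ^ 2 := by
  set s := {ω | 0 < maxPartialSum A (f - Lp.const 2 μ c) N ω}
  set t := {ω | 0 < maxPartialSum A (-f - Lp.const 2 μ c) N ω}
  set G : Ω → ℝ := fun ω => ∑ j ∈ Finset.range N,
    (j + 1 : ℝ) * ((A ^ j) f - (A ^ (j + 1)) f : Lp ℝ 2 μ) ω ^ 2
  set r := {ω | c ^ 2 ≤ G ω}
  have hs : μ.real s ≤ ‖f‖ / c := by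
    rw [le_div_iff₀' hc]
    exact measureReal_maxPartialSum_sub_const_pos_le hA hint f c N
  have ht : μ.real t ≤ ‖f‖ / c := by
    rw [le_div_iff₀' hc, ← norm_neg f]
    exact measureReal_maxPartialSum_sub_const_pos_le hA hint (-f) c N
  have hGi : ∀ j ∈ Finset.range N, Integrable
      (fun ω => (j + 1 : ℝ) * ((A ^ j) f - (A ^ (j + 1)) f : Lp ℝ 2 μ) ω ^ 2) μ :=
    fun j _ => ((Lp.memLp _).integrable_sq).const_mul _
  have hr : μ.real r ≤ ‖f‖ ^ 2 / c ^ 2 := by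
    rw [le_div_iff₀' (by positivity)]
    refine (mul_meas_ge_le_integral_of_nonneg (f := G)
      (ae_of_all _ fun ω => Finset.sum_nonneg fun j _ => by positivity)
      (integrable_finsetSum _ hGi) (c ^ 2)).trans ?_
    rw [integral_finsetSum _ hGi]
    simp_rw [integral_const_mul, integral_sq_eq_norm_sq]
    exact sum_mul_norm_pow_sub_sq_le hsymm hpsd hcontr f N
  have hsub : ({ω | ∃ n < N, 2 * c < |(A ^ n) f ω|} : Set Ω) ≤ᵐ[μ] (s ∪ t ∪ r : Set Ω) := by
    have h1 : ∀ᵐ ω ∂μ, ∀ n, n ≤ N → ω ∉ s → ∑ k ∈ Finset.range n, (A ^ k) f ω ≤ n * c := by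
      refine ae_all_iff.2 fun n => ?_
      by_cases hn : n ≤ N
      · filter_upwards [ae_sum_pow_le_of_maxPartialSum_nonpos hA (hconst c) f hn] with ω h _
        exact h
      · exact ae_of_all _ fun ω h => absurd h hn
    have h2 : ∀ᵐ ω ∂μ, ∀ n, n ≤ N → ω ∉ t → ∑ k ∈ Finset.range n, (A ^ k) (-f) ω ≤ n * c := by
      refine ae_all_iff.2 fun n => ?_
      by_cases hn : n ≤ N
      · filter_upwards [ae_sum_pow_le_of_maxPartialSum_nonpos hA (hconst c) (-f) hn] with ω h _
        exact h
      · exact ae_of_all _ fun ω h => absurd h hn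
    have h3 : ∀ᵐ ω ∂μ, ∀ n, (A ^ n) (-f) ω = -(A ^ n) f ω := by
      refine ae_all_iff.2 fun n => ?_
      rw [map_neg]
      exact Lp.coeFn_neg _
    have h4 : ∀ᵐ ω ∂μ, ∀ n, ((A ^ n) f - (A ^ (n + 1)) f : Lp ℝ 2 μ) ω
        = (A ^ n) f ω - (A ^ (n + 1)) f ω := ae_all_iff.2 fun n => Lp.coeFn_sub _ _
    filter_upwards [h1, h2, h3, h4] with ω h1 h2 h3 h4 hω
    obtain ⟨n, hn, hlt⟩ := hω
    by_contra hmem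
    obtain ⟨hst, hωr⟩ := not_or.1 hmem
    obtain ⟨hωs, hωt⟩ := not_or.1 hst
    refine absurd hlt (not_lt.2 (abs_le_two_mul_of_abs_sum_le (u := fun n => (A ^ n) f ω)
      hc.le hn ?_ ?_))
    · have e1 := h1 (n + 1) hn hωs
      have e2 := h2 (n + 1) hn hωt
      simp_rw [h3] at e2
      rw [Finset.sum_neg_distrib] at e2
      rw [Nat.cast_succ] at e1 e2
      exact abs_le.2 ⟨by linarith, e1⟩
    · have := (not_le.1 (show ¬ c ^ 2 ≤ G ω from hωr)).le
      simp only [G, h4] at this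
      exact this
  calc μ.real {ω | ∃ n < N, 2 * c < |(A ^ n) f ω|} ≤ μ.real (s ∪ t ∪ r) :=
        ENNReal.toReal_mono (measure_ne_top _ _) (measure_mono_ae hsub)
    _ ≤ μ.real s + μ.real t + μ.real r := (measureReal_union_le _ _).trans
        (by gcongr; exact measureReal_union_le _ _)
    _ ≤ _ := by gcongr

theorem measure_exists_lt_abs_pow_le [IsProbabilityMeasure μ]
    {A : Lp ℝ 2 μ →L[ℝ] Lp ℝ 2 μ}
    (hsymm : ∀ x y, inner ℝ (A x) y = inner ℝ x (A y)) (hpsd : ∀ x, 0 ≤ inner ℝ (A x) x)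
    (hcontr : ∀ x, ‖A x‖ ≤ ‖x‖)
    (hA : ∀ f, 0 ≤ f → 0 ≤ A f) (hint : ∀ f, ∫ ω, A f ω ∂μ = ∫ ω, f ω ∂μ)
    (hconst : ∀ c, A (Lp.const 2 μ c) = Lp.const 2 μ c) (f : Lp ℝ 2 μ) {c : ℝ} (hc : 0 < c) :
    μ {ω | ∃ n, 2 * c < |(A ^ n) f ω|} ≤
      ENNReal.ofReal (‖f‖ / c + ‖f‖ / c + ‖f‖ ^ 2 / c ^ 2) := by
  have hU : {ω | ∃ n, 2 * c < |(A ^ n) f ω|} = ⋃ N : ℕ, {ω | ∃ n < N, 2 * c < |(A ^ n) f ω|} := by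
    ext ω
    simp only [Set.mem_ofPred_eq, Set.mem_iUnion]
    exact ⟨fun ⟨n, h⟩ => ⟨n + 1, n, Nat.lt_succ_self n, h⟩, fun ⟨_, n, _, h⟩ => ⟨n, h⟩⟩
  have hmono : Monotone fun N : ℕ => {ω | ∃ n < N, 2 * c < |(A ^ n) f ω|} :=
    fun M N h ω ⟨n, hn, hlt⟩ => ⟨n, hn.trans_le h, hlt⟩
  rw [hU, hmono.measure_iUnion]
  refine iSup_le fun N => ?_
  rw [← ofReal_measureReal]
  exact ENNReal.ofReal_le_ofReal
    (measureReal_exists_lt_abs_pow_le hsymm hpsd hcontr hA hint hconst f hc N)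

theorem ae_tendsto_pow_apply_zero_of_orthogonal_fixed [IsProbabilityMeasure μ]
    {A : Lp ℝ 2 μ →L[ℝ] Lp ℝ 2 μ}
    (hsymm : ∀ x y, inner ℝ (A x) y = inner ℝ x (A y)) (hpsd : ∀ x, 0 ≤ inner ℝ (A x) x)
    (hcontr : ∀ x, ‖A x‖ ≤ ‖x‖)
    (hA : ∀ f, 0 ≤ f → 0 ≤ A f) (hint : ∀ f, ∫ ω, A f ω ∂μ = ∫ ω, f ω ∂μ)
    (hconst : ∀ c, A (Lp.const 2 μ c) = Lp.const 2 μ c) {z : Lp ℝ 2 μ}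
    (hz : ∀ y, A y = y → inner ℝ z y = 0) :
    ∀ᵐ ω ∂μ, Tendsto (fun n => (A ^ n) z ω) atTop (nhds 0) := by
  have key : ∀ c : ℝ, 0 < c → ∀ᵐ ω ∂μ, ∀ᶠ n in atTop, |(A ^ n) z ω| ≤ 3 * c := by
    intro c hc
    have hlim : Tendsto (fun ε : ℝ => ENNReal.ofReal (ε / c + ε / c + ε ^ 2 / c ^ 2))
        (nhdsWithin 0 (Set.Ioi 0)) (nhds 0) := by
      have : ContinuousAt (fun ε : ℝ => ENNReal.ofReal (ε / c + ε / c + ε ^ 2 / c ^ 2)) 0 :=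
        ENNReal.continuous_ofReal.continuousAt.comp (by fun_prop)
      simpa using this.tendsto.mono_left nhdsWithin_le_nhds
    rw [ae_iff, ← nonpos_iff_eq_zero]
    refine ge_of_tendsto hlim (eventually_mem_nhdsWithin.mono fun ε hε => ?_)
    obtain ⟨y, hy⟩ := exists_norm_sub_lt_of_orthogonal_fixed hsymm hz hε
    set R := z - (y - A y) with hR
    have hd := ae_tendsto_zero_of_summable_norm_sq (summable_norm_pow_sub_sq hsymm hpsd hcontr y)
    have hdecomp : ∀ᵐ ω ∂μ, ∀ n, (A ^ n) z ω
        = (A ^ n) R ω + ((A ^ n) y - (A ^ (n + 1)) y : Lp ℝ 2 μ) ω := by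
      refine ae_all_iff.2 fun n => ?_
      have h4 : (A ^ n) z = (A ^ n) R + ((A ^ n) y - (A ^ (n + 1)) y) := by
        rw [pow_succ, mul_apply_eq_comp, hR, map_sub, map_sub]; abel
      rw [h4]
      exact Lp.coeFn_add _ _
    have hsub : ({ω | ¬ ∀ᶠ n in atTop, |(A ^ n) z ω| ≤ 3 * c} : Set Ω) ≤ᵐ[μ]
        ({ω | ∃ n, 2 * c < |(A ^ n) R ω|} : Set Ω) := by
      filter_upwards [hd, hdecomp] with ω h1 h2 hω
      by_contra hnot
      have hnot' : ∀ n, |(A ^ n) R ω| ≤ 2 * c := fun n => not_lt.1 fun h => hnot ⟨n, h⟩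
      refine hω ?_
      filter_upwards [h1.abs.eventually_le_const (by simpa using hc)] with n hn
      rw [h2]
      exact (abs_add_le _ _).trans (by linarith [hnot' n])
    refine (measure_mono_ae hsub).trans ((measure_exists_lt_abs_pow_le hsymm hpsd hcontr hA
      hint hconst R hc).trans (ENNReal.ofReal_le_ofReal ?_))
    gcongr
  have hall : ∀ᵐ ω ∂μ, ∀ k : ℕ, ∀ᶠ n in atTop, |(A ^ n) z ω| ≤ 3 * (1 / (k + 1 : ℝ)) :=
    ae_all_iff.2 fun k => key _ (by positivity)
  filter_upwards [hall] with ω hω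
  rw [Metric.tendsto_nhds]
  intro ε hε
  obtain ⟨k, hk⟩ := exists_nat_one_div_lt (show (0 : ℝ) < ε / 3 by positivity)
  filter_upwards [hω k] with n hn
  rw [dist_zero_right, Real.norm_eq_abs]
  linarith

end MaximalInequality

section Completion

variable {Ω : Type*} {m0 : MeasurableSpace Ω} {μ : Measure Ω}

/-- Adding null sets to `m` does not change almost everywhere measurability. -/
theorem aestronglyMeasurable_of_sup_null [IsFiniteMeasure μ] {m N : MeasurableSpace Ω}
    (hm : m ≤ m0)
    (hN : N = MeasurableSpace.generateFrom {s : Set Ω | MeasurableSet[m0] s ∧ μ s = 0})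
    {f : Ω → ℝ} (hf : Integrable f μ) (hfm : AEStronglyMeasurable[m ⊔ N] f μ) :
    AEStronglyMeasurable[m] f μ := by
  have hle : m ⊔ N ≤ eventuallyMeasurableSpace m (ae μ) := by
    refine sup_le (@le_eventuallyMeasurableSpace _ m (ae μ) _) ?_
    rw [hN]
    refine MeasurableSpace.generateFrom_le fun s hs => ⟨∅, @MeasurableSet.empty _ m, ?_⟩
    exact ae_eq_empty.2 hs.2
  have hNm : N ≤ m0 := by
    rw [hN]
    exact MeasurableSpace.generateFrom_le fun s hs => hs.1
  have h1 : f =ᵐ[μ] μ[f | m ⊔ N] :=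
    (condExp_of_aestronglyMeasurable' (sup_le hm hNm) hfm hf).symm
  have h2 : μ[f | m] =ᵐ[μ] μ[f | m ⊔ N] := by
    refine ae_eq_condExp_of_forall_setIntegral_eq (sup_le hm hNm) hf
      (fun s _ _ => integrable_condExp.integrableOn) (fun s hs _ => ?_)
      (stronglyMeasurable_condExp.mono le_sup_left).aestronglyMeasurable
    obtain ⟨t, ht, hst⟩ := hle s hs
    rw [setIntegral_congr_set hst, setIntegral_congr_set hst, setIntegral_condExp hm hf ht]
  exact ⟨μ[f | m], stronglyMeasurable_condExp, h1.trans h2.symm⟩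

theorem measurable_of_ae_eq_of_null_le {K N : MeasurableSpace Ω}
    (hN : N = MeasurableSpace.generateFrom {s : Set Ω | MeasurableSet[m0] s ∧ μ s = 0})
    (hNK : N ≤ K) (hK : K ≤ m0) {g h : Ω → ℝ} (hg : Measurable[m0] g) (hh : Measurable[K] h)
    (hgh : g =ᵐ[μ] h) : Measurable[K] g := by
  have hnull : ∀ s, MeasurableSet[m0] s → μ s = 0 → MeasurableSet[K] s := fun s hs h0 =>
    hNK s (by rw [hN]; exact MeasurableSpace.measurableSet_generateFrom ⟨hs, h0⟩)
  have hD : MeasurableSet[m0] {ω | g ω = h ω}ᶜ :=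
    (measurableSet_eq_fun hg (hh.mono hK le_rfl)).compl
  have hD0 : μ {ω | g ω = h ω}ᶜ = 0 := hgh
  have hDK := hnull _ hD hD0
  intro s hs
  have e : g ⁻¹' s = (h ⁻¹' s \ {ω | g ω = h ω}ᶜ) ∪ (g ⁻¹' s ∩ {ω | g ω = h ω}ᶜ) := by
    ext ω
    by_cases hω : g ω = h ω
    · simp [hω]
    · simp [hω]
  rw [e]
  exact MeasurableSet.union (MeasurableSet.diff (hh hs) hDK)
    (hnull _ (MeasurableSet.inter (hg hs) hD) (measure_mono_null Set.inter_subset_right hD0))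

theorem aestronglyMeasurable_inf_sup_null_iff [IsFiniteMeasure μ] {G1 G2 N : MeasurableSpace Ω}
    (hG1 : G1 ≤ m0) (hG2 : G2 ≤ m0)
    (hN : N = MeasurableSpace.generateFrom {s : Set Ω | MeasurableSet[m0] s ∧ μ s = 0})
    {f : Ω → ℝ} (hf : Integrable f μ) :
    AEStronglyMeasurable[(G1 ⊔ N) ⊓ (G2 ⊔ N)] f μ ↔
      AEStronglyMeasurable[G1] f μ ∧ AEStronglyMeasurable[G2] f μ := by
  have hNm : N ≤ m0 := by
    rw [hN]
    exact MeasurableSpace.generateFrom_le fun s hs => hs.1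
  constructor
  · intro h
    have hle1 : (G1 ⊔ N) ⊓ (G2 ⊔ N) ≤ G1 ⊔ N := inf_le_left
    have hle2 : (G1 ⊔ N) ⊓ (G2 ⊔ N) ≤ G2 ⊔ N := inf_le_right
    exact ⟨aestronglyMeasurable_of_sup_null hG1 hN hf (h.mono hle1),
      aestronglyMeasurable_of_sup_null hG2 hN hf (h.mono hle2)⟩
  · rintro ⟨⟨g1, hg1, h1⟩, ⟨g2, hg2, h2⟩⟩
    have hm2 : Measurable[G2 ⊔ N] g1 := measurable_of_ae_eq_of_null_le hN le_sup_right
      (sup_le hG2 hNm) (hg1.measurable.mono hG1 le_rfl)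
      (hg2.measurable.mono le_sup_left le_rfl) (h1.symm.trans h2)
    have hm1 : Measurable[G1 ⊔ N] g1 := hg1.measurable.mono le_sup_left le_rfl
    have hm : Measurable[(G1 ⊔ N) ⊓ (G2 ⊔ N)] g1 := fun s hs => ⟨hm1 hs, hm2 hs⟩
    exact ⟨g1, hm.stronglyMeasurable, h1⟩

end Completion

section Alternating

variable {Ω : Type*} {m0 : MeasurableSpace Ω} {μ : Measure Ω}

/-- An orthogonal projection on `L²` which is also a Markov operator. -/
structure IsMarkovProjection [IsFiniteMeasure μ] (T : Lp ℝ 2 μ →L[ℝ] Lp ℝ 2 μ) : Prop where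
  inner_left : ∀ x y, inner ℝ (T x) y = inner ℝ x (T y)
  idem : ∀ x, T (T x) = T x
  nonneg : ∀ f, 0 ≤ f → 0 ≤ T f
  integral : ∀ f, ∫ ω, T f ω ∂μ = ∫ ω, f ω ∂μ
  const : ∀ c, T (Lp.const 2 μ c) = Lp.const 2 μ c

theorem IsMarkovProjection.norm_sub_sq [IsFiniteMeasure μ] {T : Lp ℝ 2 μ →L[ℝ] Lp ℝ 2 μ}
    (hT : IsMarkovProjection T) (x : Lp ℝ 2 μ) : ‖x - T x‖ ^ 2 = ‖x‖ ^ 2 - ‖T x‖ ^ 2 := by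
  have h : inner ℝ x (T x) = ‖T x‖ ^ 2 := by
    rw [← real_inner_self_eq_norm_sq, hT.inner_left, hT.idem]
  rw [norm_sub_sq_real, h]
  ring

theorem IsMarkovProjection.norm_apply_le [IsFiniteMeasure μ] {T : Lp ℝ 2 μ →L[ℝ] Lp ℝ 2 μ}
    (hT : IsMarkovProjection T) (x : Lp ℝ 2 μ) : ‖T x‖ ≤ ‖x‖ := by
  have h := hT.norm_sub_sq x
  exact le_of_sq_le_sq (by nlinarith [sq_nonneg ‖x - T x‖]) (norm_nonneg _)

theorem IsMarkovProjection.of_condExp [IsFiniteMeasure μ] {G : MeasurableSpace Ω} (hG : G ≤ m0)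
    {T : Lp ℝ 2 μ →L[ℝ] Lp ℝ 2 μ}
    (hT : ∀ X : Lp ℝ 2 μ, (T X : Ω → ℝ) =ᵐ[μ] μ[(X : Ω → ℝ) | G]) : IsMarkovProjection T := by
  have hfact : Fact (G ≤ m0) := ⟨hG⟩
  have hTP : ∀ X, T X = (@lpMeas Ω ℝ ℝ _ _ _ G m0 2 μ).starProjection X := by
    intro X
    refine Lp.ext ((hT X).trans ?_)
    have h := (Lp.memLp X).condExpL2_ae_eq_condExp (𝕜 := ℝ) hG
    rw [Lp.toLp_coeFn] at h
    exact h.symm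
  refine ⟨fun x y => ?_, fun x => ?_, fun f hf => ?_, fun f => ?_, fun c => ?_⟩
  · rw [hTP, hTP, Submodule.inner_starProjection_left_eq_right]
  · rw [hTP, hTP]
    exact Submodule.starProjection_eq_self_iff.2 (Submodule.starProjection_apply_mem _ _)
  · rw [← Lp.coeFn_nonneg] at hf ⊢
    exact (condExp_nonneg hf).trans (hT f).symm.le
  · rw [integral_congr_ae (hT f), integral_condExp hG]
  · refine Lp.ext ((hT _).trans ((condExp_congr_ae (Lp.coeFn_const 2 μ c)).trans ?_))
    refine EventuallyEq.trans ?_ (Lp.coeFn_const 2 μ c).symm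
    exact (condExp_const hG c (μ := μ)).eventuallyEq

theorem apply_eq_self_iff_aestronglyMeasurable [IsFiniteMeasure μ] {G : MeasurableSpace Ω}
    (hG : G ≤ m0) {T : Lp ℝ 2 μ →L[ℝ] Lp ℝ 2 μ}
    (hT : ∀ X : Lp ℝ 2 μ, (T X : Ω → ℝ) =ᵐ[μ] μ[(X : Ω → ℝ) | G]) (f : Lp ℝ 2 μ) :
    T f = f ↔ AEStronglyMeasurable[G] f μ := by
  constructor
  · intro h
    have h1 := hT f
    rw [h] at h1
    exact ⟨_, stronglyMeasurable_condExp, h1⟩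
  · intro h
    exact Lp.ext ((hT f).trans (condExp_of_aestronglyMeasurable' hG h
      ((Lp.memLp f).integrable (by norm_num))))

/-- Convergence of `(T₁ T₂ T₁)ⁿ T₁ x` to the projection `w` of `x` on the common fixed points. -/
theorem tendsto_alternating_of_isMarkovProjection [IsProbabilityMeasure μ]
    {T1 T2 : Lp ℝ 2 μ →L[ℝ] Lp ℝ 2 μ} (h1 : IsMarkovProjection T1) (h2 : IsMarkovProjection T2)
    {x w : Lp ℝ 2 μ} (hw1 : T1 w = w) (hw2 : T2 w = w)
    (hxw : ∀ f, T1 f = f → T2 f = f → inner ℝ (x - w) f = 0)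
    {u : ℕ → Lp ℝ 2 μ} (hu0 : u 0 = T1 x) (hu : ∀ n, u (n + 1) = T1 (T2 (u n))) :
    Tendsto u atTop (nhds w) ∧
      ∀ᵐ ω ∂μ, Tendsto (fun n => u n ω) atTop (nhds (w ω)) := by
  set A : Lp ℝ 2 μ →L[ℝ] Lp ℝ 2 μ := T1.comp (T2.comp T1) with hAdef
  have hAapp : ∀ y, A y = T1 (T2 (T1 y)) := fun y => rfl
  have hsymm : ∀ y z, inner ℝ (A y) z = inner ℝ y (A z) := fun y z => by
    rw [hAapp, hAapp, h1.inner_left, h2.inner_left, h1.inner_left]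
  have hpsd : ∀ y, 0 ≤ inner ℝ (A y) y := fun y => by
    rw [hAapp, h1.inner_left, ← h2.idem, h2.inner_left]
    exact real_inner_self_nonneg
  have hcontr : ∀ y, ‖A y‖ ≤ ‖y‖ := fun y =>
    (h1.norm_apply_le _).trans ((h2.norm_apply_le _).trans (h1.norm_apply_le _))
  have hA : ∀ f, 0 ≤ f → 0 ≤ A f := fun f hf => h1.nonneg _ (h2.nonneg _ (h1.nonneg _ hf))
  have hint : ∀ f, ∫ ω, A f ω ∂μ = ∫ ω, f ω ∂μ := fun f => by
    rw [hAapp, h1.integral, h2.integral, h1.integral]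
  have hconst : ∀ c, A (Lp.const 2 μ c) = Lp.const 2 μ c := fun c => by
    rw [hAapp, h1.const, h2.const, h1.const]
  have hfix : ∀ y, A y = y → T1 y = y ∧ T2 y = y := by
    intro y hy
    have e1 : T1 y = y := by
      conv_lhs => rw [← hy, hAapp, h1.idem]
      exact hy
    refine ⟨e1, ?_⟩
    have hle : ‖y‖ ≤ ‖T2 y‖ := by
      conv_lhs => rw [← hy, hAapp, e1]
      exact h1.norm_apply_le _
    have h := h2.norm_sub_sq y
    have h0 : ‖y - T2 y‖ = 0 := by
      have : ‖y‖ ^ 2 ≤ ‖T2 y‖ ^ 2 := by gcongr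
      exact pow_eq_zero_iff two_ne_zero |>.1 (le_antisymm (by linarith) (sq_nonneg _))
    exact (sub_eq_zero.1 (norm_eq_zero.1 h0)).symm
  have hz : ∀ y, A y = y → inner ℝ (T1 x - w) y = 0 := by
    intro y hy
    obtain ⟨e1, e2⟩ := hfix y hy
    have := hxw y e1 e2
    rw [inner_sub_left] at this ⊢
    rwa [h1.inner_left, e1]
  have hun : ∀ n, u n = (A ^ n) (T1 x - w) + w ∧ T1 (u n) = u n := by
    intro n
    induction n with
    | zero => simp [hu0, h1.idem]
    | succ n ih =>
      refine ⟨?_, by rw [hu, h1.idem]⟩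
      rw [hu, ← ih.2, ih.1, map_add, map_add, map_add, hw1, hw2, hw1, pow_succ',
        mul_apply_eq_comp, hAapp]
  constructor
  · have h := (tendsto_pow_apply_zero_of_orthogonal_fixed hsymm hpsd hcontr hz).add_const w
    rw [zero_add] at h
    exact h.congr fun n => (hun n).1.symm
  · have hadd : ∀ᵐ ω ∂μ, ∀ n, u n ω = (A ^ n) (T1 x - w) ω + w ω := by
      refine ae_all_iff.2 fun n => ?_
      rw [(hun n).1]
      exact Lp.coeFn_add _ _
    filter_upwards [hadd, ae_tendsto_pow_apply_zero_of_orthogonal_fixed hsymm hpsd hcontr hA hint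
      hconst hz] with ω e h
    have h' := h.add_const (w ω)
    rw [zero_add] at h'
    exact h'.congr fun n => (e n).symm

theorem tendsto_of_odd_of_even {α : Type*} {u : ℕ → α} {l : Filter α}
    (h1 : Tendsto (fun n => u (2 * n + 1)) atTop l)
    (h2 : Tendsto (fun n => u (2 * n + 2)) atTop l) : Tendsto u atTop l := by
  intro s hs
  obtain ⟨N1, hN1⟩ := eventually_atTop.1 (h1.eventually_mem hs)
  obtain ⟨N2, hN2⟩ := eventually_atTop.1 (h2.eventually_mem hs)
  refine mem_map.2 (mem_atTop_sets.2 ⟨2 * N1 + 2 * N2 + 2, fun n hn => ?_⟩)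
  obtain ⟨k, rfl | rfl⟩ : ∃ k, n = 2 * k + 1 ∨ n = 2 * k + 2 := ⟨(n - 1) / 2, by omega⟩
  · exact hN1 k (by omega)
  · exact hN2 k (by omega)

end Alternating

/-- Alternating iterates of two conditional expectation operators
`S 1 = T₁, S 2 = T₂T₁, S 3 = T₁T₂T₁, …` converge, both in `L²` and almost surely, to the
conditional expectation given `Ḡ₁ ∩ Ḡ₂`, where `Ḡᵢ` is the σ-field generated by `Gᵢ` and
the `μ`-null sets. -/
theorem alternating_condexp_tendsto
    {Ω : Type*} {m0 : MeasurableSpace Ω} {μ : Measure Ω} [IsProbabilityMeasure μ]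
    (G1 G2 : MeasurableSpace Ω) (hG1 : G1 ≤ m0) (hG2 : G2 ≤ m0)
    (T1 T2 : Lp ℝ 2 μ →L[ℝ] Lp ℝ 2 μ)
    (hT1 : ∀ X : Lp ℝ 2 μ, (T1 X : Ω → ℝ) =ᵐ[μ] μ[(X : Ω → ℝ) | G1])
    (hT2 : ∀ X : Lp ℝ 2 μ, (T2 X : Ω → ℝ) =ᵐ[μ] μ[(X : Ω → ℝ) | G2])
    (S : ℕ → Lp ℝ 2 μ →L[ℝ] Lp ℝ 2 μ)
    (hS1 : S 1 = T1)
    (hSrec : ∀ n ≥ 1, S (n + 1) = (if Even n then T1 else T2).comp (S n))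
    (N : MeasurableSpace Ω)
    (hN : N = MeasurableSpace.generateFrom {s : Set Ω | MeasurableSet[m0] s ∧ μ s = 0})
    (X : Lp ℝ 2 μ) :
    Tendsto (fun n : ℕ =>
        eLpNorm ((S n X : Ω → ℝ) - μ[(X : Ω → ℝ) | (G1 ⊔ N) ⊓ (G2 ⊔ N)]) 2 μ)
      atTop (nhds 0) ∧
      ∀ᵐ ω ∂μ, Tendsto (fun n : ℕ => S n X ω) atTop
        (nhds ((μ[(X : Ω → ℝ) | (G1 ⊔ N) ⊓ (G2 ⊔ N)]) ω)) := by
  have hN0 : N ≤ m0 := by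
    rw [hN]
    exact MeasurableSpace.generateFrom_le fun s hs => hs.1
  have hG : (G1 ⊔ N) ⊓ (G2 ⊔ N) ≤ m0 := inf_le_left.trans (sup_le hG1 hN0)
  have hfact : Fact ((G1 ⊔ N) ⊓ (G2 ⊔ N) ≤ m0) := ⟨hG⟩
  set K := @lpMeas Ω ℝ ℝ _ _ _ ((G1 ⊔ N) ⊓ (G2 ⊔ N)) m0 2 μ with hK
  set W : Lp ℝ 2 μ := K.starProjection X with hW
  have hmemK : ∀ f : Lp ℝ 2 μ, f ∈ K ↔ T1 f = f ∧ T2 f = f := fun f => by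
    rw [hK, mem_lpMeas_iff_aestronglyMeasurable, aestronglyMeasurable_inf_sup_null_iff hG1 hG2 hN
      ((Lp.memLp f).integrable (by norm_num)), apply_eq_self_iff_aestronglyMeasurable hG1 hT1,
      apply_eq_self_iff_aestronglyMeasurable hG2 hT2]
  have hWX : (W : Ω → ℝ) =ᵐ[μ] μ[(X : Ω → ℝ) | (G1 ⊔ N) ⊓ (G2 ⊔ N)] := by
    have h := (Lp.memLp X).condExpL2_ae_eq_condExp (𝕜 := ℝ) hG
    rw [Lp.toLp_coeFn] at h
    exact h
  have hP1 := IsMarkovProjection.of_condExp hG1 hT1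
  have hP2 := IsMarkovProjection.of_condExp hG2 hT2
  obtain ⟨hW1, hW2⟩ := (hmemK W).1 (Submodule.starProjection_apply_mem _ _)
  have horth : ∀ f, T1 f = f → T2 f = f → inner ℝ (X - W) f = 0 := fun f h1 h2 =>
    (Submodule.mem_orthogonal' K _).1 (Submodule.sub_starProjection_mem_orthogonal X) f
      ((hmemK f).2 ⟨h1, h2⟩)
  have hSodd : ∀ n, S (2 * n + 2) X = T2 (S (2 * n + 1) X) := fun n => by
    rw [hSrec (2 * n + 1) (by omega), if_neg (by simp)]
    rfl
  have hSeven : ∀ n, S (2 * n + 3) X = T1 (S (2 * n + 2) X) := fun n => by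
    rw [hSrec (2 * n + 2) (by omega), if_pos (by simp [Nat.even_add])]
    rfl
  obtain ⟨hLodd, haeodd⟩ := tendsto_alternating_of_isMarkovProjection hP1 hP2 hW1 hW2 horth
    (u := fun n => S (2 * n + 1) X) (by simp [hS1])
    (fun n => (hSeven n).trans (congrArg T1 (hSodd n)))
  obtain ⟨hLeven, haeeven⟩ := tendsto_alternating_of_isMarkovProjection hP2 hP1 hW2 hW1
    (x := T1 X)
    (fun f h2 h1 => by
      have := horth f h1 h2
      rw [inner_sub_left] at this ⊢
      rwa [hP1.inner_left, h1])
    (u := fun n => S (2 * n + 2) X) ((hSodd 0).trans (by simp [hS1]))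
    (fun n => (hSodd (n + 1)).trans (congrArg T2 (hSeven n)))
  constructor
  · have hL : Tendsto (fun n => S n X) atTop (nhds W) := tendsto_of_odd_of_even hLodd hLeven
    refine ((Lp.tendsto_Lp_iff_tendsto_eLpNorm' _ _).1 hL).congr fun n => ?_
    exact eLpNorm_congr_ae (EventuallyEq.rfl.sub hWX)
  · filter_upwards [haeodd, haeeven, hWX] with ω h1 h2 h3
    rw [← h3]
    exact tendsto_of_odd_of_even h1 h2
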